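/- arXiv:1110.2706 — 2 statements merged into one kernel-verified Lean document; each statement's English description precedes it below -/
import Mathlib

section
/- Let d ∈ {1,…,p}. The ideal 𝔪^{2p−1−d} of A, viewed as an A-module, lies in EIP_d, and every A-submodule of A lying in EIP_d is contained in 𝔪^{2p−1−d} (so 𝔪^{2p−1−d} is the largest EIP_d submodule of A); moreover 𝔪^{2p−1−d} is isomorphic to W_{d,d} as an A-module. -/
open MvPolynomial Module

set_option maxHeartbeats 1000000
set_option synthInstance.maxHeartbeats 400000

noncomputable section

/-- The defining ideal `(X^p, Y^p)` of the polynomial ring in two variables. -/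
def relI (k : Type) [Field k] (p : ℕ) : Ideal (MvPolynomial (Fin 2) k) :=
  Ideal.span {(X 0 : MvPolynomial (Fin 2) k) ^ p, (X 1 : MvPolynomial (Fin 2) k) ^ p}

/-- The algebra `A = k[X,Y]/(X^p, Y^p)`. -/
abbrev Amod (k : Type) [Field k] (p : ℕ) : Type :=
  MvPolynomial (Fin 2) k ⧸ relI k p

variable (k : Type) [Field k] (p : ℕ)

/-- `x`, the image of `X` in `A`. -/
def xA : Amod k p := Ideal.Quotient.mk (relI k p) (X 0)

/-- `y`, the image of `Y` in `A`. -/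
def yA : Amod k p := Ideal.Quotient.mk (relI k p) (X 1)

/-- The maximal ideal `𝔪 = (x, y)` of `A`. -/
def mA : Ideal (Amod k p) := Ideal.span {xA k p, yA k p}

/-- A point operator: `u = α x + β y` with `(α, β) ≠ (0, 0)`. -/
def IsPointOp (u : Amod k p) : Prop :=
  ∃ α β : k, (α ≠ 0 ∨ β ≠ 0) ∧ u = α • xA k p + β • yA k p

/-- Equal images property: `u M = 𝔪 M` for every point operator `u`. -/
def EIP (M : Type) [AddCommGroup M] [Module (Amod k p) M] : Prop :=
  ∀ u : Amod k p, IsPointOp k p u →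
    LinearMap.range (LinearMap.lsmul (Amod k p) M u)
      = mA k p • (⊤ : Submodule (Amod k p) M)

/-- `M` lies in `EIP_d`: equal images property and `𝔪^d M = 0`. -/
def EIPd (d : ℕ) (M : Type) [AddCommGroup M] [Module (Amod k p) M] : Prop :=
  EIP k p M ∧ (mA k p) ^ d • (⊤ : Submodule (Amod k p) M) = ⊥


/-- The standard basis vector `v_i` of the free module `A^n`. -/
def stdV (n : ℕ) (i : Fin n) : Fin n → Amod k p := Pi.single i 1

/-- The set of defining relations of the module `W_{n,d}` inside the free module `A^n`
(indices of `v_1, …, v_n` are `0, …, n-1`): `x·v_1`, `y·v_n`, `x^d·v_i` for `2 ≤ i ≤ n`,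
and `y·v_i − x·v_{i+1}` for `1 ≤ i ≤ n−1`. -/
def NSet (n d : ℕ) : Set (Fin n → Amod k p) :=
  (⋃ (i : Fin n) (_ : i.val = 0), {xA k p • stdV k p n i}) ∪
  (⋃ (i : Fin n) (_ : i.val = n - 1), {yA k p • stdV k p n i}) ∪
  (⋃ (i : Fin n) (_ : i.val ≠ 0), {(xA k p) ^ d • stdV k p n i}) ∪
  (⋃ (i : Fin n) (j : Fin n) (_ : j.val = i.val + 1),
    {yA k p • stdV k p n i - xA k p • stdV k p n j})

/-- The submodule `N_{n,d} ⊆ A^n` of defining relations of `W_{n,d}`. -/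
def NSub (n d : ℕ) : Submodule (Amod k p) (Fin n → Amod k p) :=
  Submodule.span (Amod k p) (NSet k p n d)

/-- The module `W_{n,d} = A^n / N_{n,d}`. -/
abbrev Wmod (n d : ℕ) : Type := (Fin n → Amod k p) ⧸ NSub k p n d

/-- Powers of a two-generated ideal are generated by the monomials. -/
lemma span_pair_pow_le {R : Type} [CommRing R] (u v : R) (n : ℕ) (K : Ideal R)
    (h : ∀ i j, i + j = n → u ^ i * v ^ j ∈ K) : (Ideal.span {u, v}) ^ n ≤ K := by
  have key : (Ideal.span {u, v}) ^ n ≤ Ideal.span {z | ∃ i j, i + j = n ∧ z = u ^ i * v ^ j} := by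
    clear h
    induction n with
    | zero =>
      have : (1 : R) ∈ Ideal.span {z | ∃ i j, i + j = 0 ∧ z = u ^ i * v ^ j} :=
        Ideal.subset_span ⟨0, 0, by simp⟩
      rw [(Ideal.eq_top_iff_one _).2 this]
      exact le_top
    | succ n ih =>
      rw [pow_succ]
      refine (Ideal.mul_mono_left ih).trans ?_
      rw [Ideal.span_mul_span', Ideal.span_le]
      rintro _ ⟨_, ⟨i, j, hij, rfl⟩, w, hw, rfl⟩
      rcases hw with rfl | hw
      · exact Ideal.subset_span ⟨i + 1, j, by omega, by simp only; ring⟩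
      · rw [Set.mem_singleton_iff] at hw
        subst hw
        exact Ideal.subset_span ⟨i, j + 1, by omega, by simp only; ring⟩
  refine key.trans ?_
  rw [Ideal.span_le]
  rintro _ ⟨i, j, hij, rfl⟩
  exact h i j hij

lemma mul_mem_pow_add {R : Type} [CommRing R] (I : Ideal R) {a b : R} {i j : ℕ}
    (ha : a ∈ I ^ i) (hb : b ∈ I ^ j) : a * b ∈ I ^ (i + j) := by
  rw [pow_add]; exact Ideal.mul_mem_mul ha hb

lemma smulk_mem_gen {k R : Type} [Field k] [CommRing R] [Algebra k R] (I : Ideal R) (c : k)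
    {z : R} (h : z ∈ I) : c • z ∈ I := by
  rw [Algebra.smul_def]
  exact I.mul_mem_left _ h

section gen
variable {R W : Type} [CommRing R] [AddCommGroup W] [Module R W] (x y : R) (V : ℕ → W)

lemma gen_xpow (hy : ∀ i, y • V i = x • V (i + 1)) (i : ℕ) : x ^ i • V i = y ^ i • V 0 := by
  induction i with
  | zero => simp
  | succ i ih =>
    rw [pow_succ, mul_smul, ← hy, smul_comm, ih, smul_smul, ← pow_succ']

lemma gen_xpow_zero (h0 : x • V 0 = 0) (hy : ∀ i, y • V i = x • V (i + 1)) (i a : ℕ) (h : i < a) :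
    x ^ a • V i = 0 := by
  obtain ⟨c, rfl⟩ : ∃ c, a = c + 1 + i := ⟨a - i - 1, by omega⟩
  rw [pow_add, mul_smul, gen_xpow x y V hy, smul_comm, pow_succ, mul_smul, h0, smul_zero, smul_zero]

lemma gen_ypow (hy : ∀ i, y • V i = x • V (i + 1)) (i b : ℕ) : y ^ b • V i = x ^ b • V (i + b) := by
  induction b with
  | zero => simp
  | succ b ih =>
    rw [pow_succ', mul_smul, ih, smul_comm, hy, smul_smul, ← pow_succ, add_assoc]

lemma gen_mono (hy : ∀ i, y • V i = x • V (i + 1)) (i a b : ℕ) :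
    (x ^ a * y ^ b) • V i = x ^ (a + b) • V (i + b) := by
  rw [mul_smul, gen_ypow x y V hy, smul_smul, ← pow_add]

end gen

lemma xA_pow : xA k p ^ p = 0 := by
  rw [xA, ← map_pow, Ideal.Quotient.eq_zero_iff_mem]
  exact Ideal.subset_span (by simp)

lemma yA_pow : yA k p ^ p = 0 := by
  rw [yA, ← map_pow, Ideal.Quotient.eq_zero_iff_mem]
  exact Ideal.subset_span (by simp)

lemma xA_pow_ge {n : ℕ} (h : p ≤ n) : xA k p ^ n = 0 := pow_eq_zero_of_le h (xA_pow k p)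

lemma yA_pow_ge {n : ℕ} (h : p ≤ n) : yA k p ^ n = 0 := pow_eq_zero_of_le h (yA_pow k p)

/-- The exponent `(a, b)`. -/
def ex2 (a b : ℕ) : Fin 2 →₀ ℕ := Finsupp.single 0 a + Finsupp.single 1 b

lemma ex2_zero (a b : ℕ) : ex2 a b 0 = a := by simp [ex2]

lemma ex2_one (a b : ℕ) : ex2 a b 1 = b := by simp [ex2]

lemma ex2_inj {a b a' b' : ℕ} : ex2 a b = ex2 a' b' ↔ a = a' ∧ b = b' := by
  constructor
  · intro h
    exact ⟨by rw [← ex2_zero a b, h, ex2_zero], by rw [← ex2_one a b, h, ex2_one]⟩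
  · rintro ⟨rfl, rfl⟩; rfl

lemma monomial_ex2 (a b : ℕ) :
    (monomial (ex2 a b) (1 : k) : MvPolynomial (Fin 2) k) = X 0 ^ a * X 1 ^ b := by
  rw [X_pow_eq_monomial, X_pow_eq_monomial, monomial_mul, one_mul, ex2]

lemma eq_ex2 (s : Fin 2 →₀ ℕ) : s = ex2 (s 0) (s 1) := by
  ext i
  fin_cases i
  · exact (ex2_zero _ _).symm
  · exact (ex2_one _ _).symm

/-- Coefficient functional on polynomials, set to `0` outside of the box. -/
def cfP (a b : ℕ) : MvPolynomial (Fin 2) k →ₗ[k] k :=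
  if a < p ∧ b < p then lcoeff k (ex2 a b) else 0

lemma cfP_relI (a b : ℕ) (f : MvPolynomial (Fin 2) k) (hf : f ∈ relI k p) :
    cfP k p a b f = 0 := by
  unfold cfP
  split_ifs with h
  · rw [relI, Ideal.mem_span_pair] at hf
    obtain ⟨g, g', rfl⟩ := hf
    rw [lcoeff_apply, coeff_add, X_pow_eq_monomial, X_pow_eq_monomial, coeff_mul_monomial',
      coeff_mul_monomial', if_neg, if_neg, add_zero]
    · rw [Finsupp.single_le_iff, ex2_one]; omega
    · rw [Finsupp.single_le_iff, ex2_zero]; omega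
  · rfl

/-- Coefficient functional on `A`. -/
def cf (a b : ℕ) : Amod k p →ₗ[k] k :=
  Submodule.liftQ ((relI k p).restrictScalars k) (cfP k p a b)
    (fun f hf => cfP_relI k p a b f hf)

lemma cf_mk (a b : ℕ) (f : MvPolynomial (Fin 2) k) :
    cf k p a b (Ideal.Quotient.mk (relI k p) f) = cfP k p a b f := rfl

lemma mono_eq (i j : ℕ) : xA k p ^ i * yA k p ^ j =
    Ideal.Quotient.mk (relI k p) (monomial (ex2 i j) 1) := by
  rw [monomial_ex2]; simp [xA, yA]

lemma cf_mono (a b i j : ℕ) : cf k p a b (xA k p ^ i * yA k p ^ j) =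
    if i = a ∧ j = b ∧ a < p ∧ b < p then 1 else 0 := by
  classical
  rw [mono_eq, cf_mk, cfP]
  split_ifs with h1 h2 h2
  · rw [lcoeff_apply, coeff_monomial, if_pos]
    rw [ex2_inj]; omega
  · rw [lcoeff_apply, coeff_monomial, if_neg]
    rw [ex2_inj]; omega
  · omega
  · rfl

lemma extA {M : Type} [AddCommGroup M] [Module k M] (F G : Amod k p →ₗ[k] M)
    (h : ∀ i j, F (xA k p ^ i * yA k p ^ j) = G (xA k p ^ i * yA k p ^ j)) : F = G := by
  refine LinearMap.ext fun z => ?_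
  obtain ⟨f, rfl⟩ := Ideal.Quotient.mk_surjective z
  induction f using MvPolynomial.induction_on' with
  | monomial s c =>
    have : Ideal.Quotient.mk (relI k p) (monomial s c) =
        c • (xA k p ^ (s 0) * yA k p ^ (s 1)) := by
      rw [mono_eq, ← eq_ex2, ← Ideal.Quotient.mkₐ_eq_mk k, ← map_smul, smul_monomial,
        smul_eq_mul, mul_one]
    rw [this, map_smul, map_smul, h]
  | add f g hf hg => rw [map_add, map_add, map_add, hf, hg]

lemma expandA (z : Amod k p) : z = ∑ q ∈ Finset.range p ×ˢ Finset.range p,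
    cf k p q.1 q.2 z • (xA k p ^ q.1 * yA k p ^ q.2) := by
  have : (LinearMap.id : Amod k p →ₗ[k] Amod k p) =
      ∑ q ∈ Finset.range p ×ˢ Finset.range p,
        (cf k p q.1 q.2).smulRight (xA k p ^ q.1 * yA k p ^ q.2) := by
    apply extA
    intro i j
    simp only [LinearMap.id_apply, LinearMap.sum_apply, LinearMap.smulRight_apply, cf_mono]
    by_cases hij : i < p ∧ j < p
    · rw [Finset.sum_eq_single (i, j)]
      · simp [hij]
      · rintro ⟨a, b⟩ _ hne
        rw [if_neg, zero_smul]
        rintro ⟨rfl, rfl, _⟩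
        exact hne rfl
      · intro hn
        simp [hij] at hn
    · rw [Finset.sum_eq_zero]
      · rcases not_and_or.1 hij with h | h
        · rw [xA_pow_ge k p (not_lt.1 h), zero_mul]
        · rw [yA_pow_ge k p (not_lt.1 h), mul_zero]
      · rintro ⟨a, b⟩ _
        rw [if_neg, zero_smul]
        simp only
        omega
  conv_lhs => rw [← LinearMap.id_apply (R := k) z, this]
  simp

lemma cf_shift (a b s t : ℕ) (ha : a + s < p) (hb : b + t < p) (z : Amod k p) :
    cf k p (a + s) (b + t) (xA k p ^ s * yA k p ^ t * z) = cf k p a b z := by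
  have : (cf k p (a + s) (b + t)).comp
      (LinearMap.mulLeft k (xA k p ^ s * yA k p ^ t)) = cf k p a b := by
    apply extA
    intro i j
    rw [LinearMap.comp_apply, LinearMap.mulLeft_apply,
      show xA k p ^ s * yA k p ^ t * (xA k p ^ i * yA k p ^ j) =
        xA k p ^ (i + s) * yA k p ^ (j + t) by ring, cf_mono, cf_mono]
    congr 1
    apply propext
    omega
  rw [← this]; rfl

lemma x_mem : xA k p ∈ mA k p := Ideal.subset_span (by simp)

lemma y_mem : yA k p ∈ mA k p := Ideal.subset_span (by simp)

lemma mono_mem {i j n : ℕ} (h : n ≤ i + j) : xA k p ^ i * yA k p ^ j ∈ mA k p ^ n := by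
  apply Ideal.pow_le_pow_right h
  exact mul_mem_pow_add _ (Ideal.pow_mem_pow (x_mem k p) i) (Ideal.pow_mem_pow (y_mem k p) j)

lemma smulk_mem (I : Ideal (Amod k p)) (c : k) {z : Amod k p} (h : z ∈ I) : c • z ∈ I := by
  exact smulk_mem_gen I c h

lemma mem_of_cf (n : ℕ) (z : Amod k p) (h : ∀ a b, a < p → b < p → a + b < n → cf k p a b z = 0) :
    z ∈ mA k p ^ n := by
  rw [expandA k p z]
  refine Submodule.sum_mem _ ?_
  rintro ⟨a, b⟩ hab
  simp only [Finset.mem_product, Finset.mem_range] at hab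
  by_cases hn : a + b < n
  · simp only [h a b hab.1 hab.2 hn, zero_smul]
    exact Submodule.zero_mem _
  · exact smulk_mem k p _ _ (mono_mem k p (by simpa using hn))

/-- The annihilator of `𝔪^d` is contained in `𝔪^{2p-1-d}`. -/
lemma ann_le (d : ℕ) (z : Amod k p) (h : ∀ w ∈ mA k p ^ d, w * z = 0) :
    z ∈ mA k p ^ (2 * p - 1 - d) := by
  apply mem_of_cf
  intro a b ha hb hab
  obtain ⟨s, t, hst, hs, ht⟩ : ∃ s t, s + t = d ∧ a + s < p ∧ b + t < p := by
    by_cases hd : d ≤ p - 1 - a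
    · exact ⟨d, 0, by omega, by omega, by omega⟩
    · exact ⟨p - 1 - a, d - (p - 1 - a), by omega, by omega, by omega⟩
  rw [← cf_shift k p a b s t hs ht, h _ (mono_mem k p (by omega)), map_zero]

lemma pow_top (n : ℕ) (hn : 2 * p - 1 ≤ n) : mA k p ^ n = ⊥ := by
  rw [eq_bot_iff]
  apply span_pair_pow_le
  intro i j hij
  rw [Submodule.mem_bot]
  by_cases hi : p ≤ i
  · rw [xA_pow_ge k p hi, zero_mul]
  · rw [yA_pow_ge k p (by omega), mul_zero]

lemma pointOp_mem (u : Amod k p) (hu : IsPointOp k p u) : u ∈ mA k p := by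
  obtain ⟨α, β, _, rfl⟩ := hu
  exact Ideal.add_mem _ (smulk_mem k p _ _ (x_mem k p)) (smulk_mem k p _ _ (y_mem k p))

lemma pointOp_compl (u : Amod k p) (hu : IsPointOp k p u) :
    ∃ v, v ^ p = 0 ∧ v ∈ mA k p ∧ mA k p ≤ Ideal.span {u, v} := by
  obtain ⟨α, β, h, rfl⟩ := hu
  by_cases hα : α = 0
  · subst hα
    have hβ : β ≠ 0 := by simpa using h
    refine ⟨xA k p, xA_pow k p, x_mem k p, ?_⟩
    rw [mA, Ideal.span_le]
    rintro _ (rfl | rfl)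
    · exact Ideal.subset_span (by simp)
    · have : yA k p = β⁻¹ • ((0 : k) • xA k p + β • yA k p) := by
        rw [zero_smul, zero_add, smul_smul, inv_mul_cancel₀ hβ, one_smul]
      have hm := smulk_mem k p (Ideal.span {(0 : k) • xA k p + β • yA k p, xA k p}) β⁻¹
        (Ideal.subset_span (Set.mem_insert _ _))
      rw [← this] at hm
      exact hm
  · refine ⟨yA k p, yA_pow k p, y_mem k p, ?_⟩
    rw [mA, Ideal.span_le]
    rintro _ (rfl | rfl)
    · have : xA k p = α⁻¹ • (α • xA k p + β • yA k p) - (α⁻¹ * β) • yA k p := by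
        rw [smul_add, smul_smul, smul_smul, inv_mul_cancel₀ hα, one_smul, add_sub_cancel_right]
      have hm := smulk_mem k p (Ideal.span {α • xA k p + β • yA k p, yA k p}) α⁻¹
        (Ideal.subset_span (Set.mem_insert _ _))
      have hm2 := smulk_mem k p (Ideal.span {α • xA k p + β • yA k p, yA k p}) (α⁻¹ * β)
        (Ideal.subset_span (Set.mem_insert_of_mem _ rfl))
      have hm3 := Ideal.sub_mem _ hm hm2
      rw [← this] at hm3
      exact hm3
    · exact Ideal.subset_span (by simp)

/-- Multiplication by a point operator maps `𝔪^n` onto `𝔪^(n+1)` for `n + 1 ≥ p`. -/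
lemma pointOp_surj (u : Amod k p) (hu : IsPointOp k p u) (n : ℕ) (hn : p ≤ n + 1)
    (w : Amod k p) (hw : w ∈ mA k p ^ (n + 1)) : ∃ z ∈ mA k p ^ n, u * z = w := by
  obtain ⟨v, hv, hvm, hle⟩ := pointOp_compl k p u hu
  have h1 : mA k p ^ (n + 1) ≤ Ideal.span {u} * mA k p ^ n := by
    refine (Ideal.pow_right_mono hle _).trans ?_
    apply span_pair_pow_le
    intro i j hij
    rcases i with _ | i
    · rw [pow_eq_zero_of_le (by omega : p ≤ j) hv, mul_zero]
      exact Ideal.zero_mem _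
    · rw [pow_succ', mul_assoc]
      refine Ideal.mul_mem_mul (Ideal.mem_span_singleton_self u) ?_
      rw [show n = i + j by omega]
      exact mul_mem_pow_add _ (Ideal.pow_mem_pow (pointOp_mem k p u hu) i)
        (Ideal.pow_mem_pow hvm j)
  exact Ideal.mem_span_singleton_mul.1 (h1 hw)

lemma eip_pow (n : ℕ) (hn : p ≤ n + 1) : EIP k p (↥(mA k p ^ n)) := by
  intro u hu
  apply le_antisymm
  · rintro _ ⟨z, rfl⟩
    exact Submodule.smul_mem_smul (pointOp_mem k p u hu) Submodule.mem_top
  · rw [Submodule.smul_le]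
    rintro r hr ⟨z, hz⟩ -
    have : r * z ∈ mA k p ^ (n + 1) := by
      rw [add_comm]; exact mul_mem_pow_add _ (by rwa [pow_one]) hz
    obtain ⟨w, hw, hwz⟩ := pointOp_surj k p u hu n hn _ this
    exact ⟨⟨w, hw⟩, Subtype.ext hwz⟩

lemma eipd_pow (d : ℕ) (hdp : d ≤ p) : EIPd k p d (↥(mA k p ^ (2 * p - 1 - d))) := by
  refine ⟨eip_pow k p _ (by omega), ?_⟩
  rw [eq_bot_iff, Submodule.smul_le]
  rintro r hr ⟨z, hz⟩ -
  have : r * z ∈ mA k p ^ (d + (2 * p - 1 - d)) := by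
    exact mul_mem_pow_add _ hr hz
  rw [pow_top k p _ (by omega), Submodule.mem_bot] at this
  rw [Submodule.mem_bot]
  exact Subtype.ext this

lemma eipd_le (d : ℕ) (J : Submodule (Amod k p) (Amod k p)) (h : EIPd k p d J) :
    J ≤ mA k p ^ (2 * p - 1 - d) := by
  intro z hz
  apply ann_le
  intro w hw
  have : w • (⟨z, hz⟩ : J) ∈ mA k p ^ d • (⊤ : Submodule (Amod k p) J) :=
    Submodule.smul_mem_smul hw Submodule.mem_top
  rw [h.2, Submodule.mem_bot] at this
  exact congrArg Subtype.val this

/-! ### The isomorphism with `W_{d,d}` -/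

/-- The generators of `𝔪^{2p-1-d}`. -/
def gA (d i : ℕ) : Amod k p := xA k p ^ (p - 1 - i) * yA k p ^ (p - d + i)

/-- The map `A^d → A`. -/
def phi0 (d : ℕ) : (Fin d → Amod k p) →ₗ[Amod k p] Amod k p :=
  Fintype.linearCombination (Amod k p) (fun i : Fin d => gA k p d i)

lemma phi0_std (d : ℕ) (i : Fin d) : phi0 k p d (stdV k p d i) = gA k p d i := by
  simp [phi0, stdV]

lemma NSub_le (d : ℕ) (hdp : d ≤ p) : NSub k p d d ≤ LinearMap.ker (phi0 k p d) := by
  rw [NSub, Submodule.span_le]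
  rintro z (((hz | hz) | hz) | hz)
  · simp only [Set.mem_iUnion, Set.mem_singleton_iff] at hz
    obtain ⟨i, hi, rfl⟩ := hz
    have := i.2
    rw [SetLike.mem_coe, LinearMap.mem_ker, map_smul, phi0_std, gA, smul_eq_mul, ← mul_assoc,
      ← pow_succ', xA_pow_ge k p (by omega), zero_mul]
  · simp only [Set.mem_iUnion, Set.mem_singleton_iff] at hz
    obtain ⟨i, hi, rfl⟩ := hz
    have := i.2
    rw [SetLike.mem_coe, LinearMap.mem_ker, map_smul, phi0_std, gA, smul_eq_mul, mul_left_comm,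
      ← pow_succ', yA_pow_ge k p (by omega), mul_zero]
  · simp only [Set.mem_iUnion, Set.mem_singleton_iff] at hz
    obtain ⟨i, hi, rfl⟩ := hz
    have := i.2
    rw [SetLike.mem_coe, LinearMap.mem_ker, map_smul, phi0_std, gA, smul_eq_mul, ← mul_assoc,
      ← pow_add, xA_pow_ge k p (by omega), zero_mul]
  · simp only [Set.mem_iUnion, Set.mem_singleton_iff] at hz
    obtain ⟨i, j, hij, rfl⟩ := hz
    have := j.2
    rw [SetLike.mem_coe, LinearMap.mem_ker, map_sub, map_smul, map_smul, phi0_std, phi0_std,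
      gA, gA, smul_eq_mul, smul_eq_mul, mul_left_comm, ← pow_succ', ← mul_assoc, ← pow_succ',
      show p - 1 - j.val + 1 = p - 1 - i.val by omega,
      show p - d + j.val = p - d + i.val + 1 by omega, sub_self]

/-- The map `W_{d,d} → A`. -/
def phi (d : ℕ) (hdp : d ≤ p) : Wmod k p d d →ₗ[Amod k p] Amod k p :=
  Submodule.liftQ (NSub k p d d) (phi0 k p d) (NSub_le k p d hdp)

/-- The classes of the standard generators, extended by zero. -/
def VW (d i : ℕ) : Wmod k p d d :=
  if h : i < d then Submodule.Quotient.mk (stdV k p d ⟨i, h⟩) else 0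

lemma phi_VW (d : ℕ) (hdp : d ≤ p) (i : ℕ) (hi : i < d) :
    phi k p d hdp (VW k p d i) = gA k p d i := by
  rw [VW, dif_pos hi]
  exact phi0_std k p d ⟨i, hi⟩

lemma x_VW_zero (d : ℕ) : xA k p • VW k p d 0 = 0 := by
  rw [VW]
  split_ifs with h
  · rw [← Submodule.Quotient.mk_smul, Submodule.Quotient.mk_eq_zero]
    apply Submodule.subset_span
    refine Or.inl (Or.inl (Or.inl ?_))
    simp only [Set.mem_iUnion, Set.mem_singleton_iff]
    exact ⟨⟨0, h⟩, rfl, rfl⟩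
  · rw [smul_zero]

lemma y_VW (d i : ℕ) : yA k p • VW k p d i = xA k p • VW k p d (i + 1) := by
  by_cases h1 : i + 1 < d
  · rw [VW, VW, dif_pos h1, dif_pos (by omega), ← Submodule.Quotient.mk_smul,
      ← Submodule.Quotient.mk_smul, Submodule.Quotient.eq]
    apply Submodule.subset_span
    refine Or.inr ?_
    simp only [Set.mem_iUnion, Set.mem_singleton_iff]
    exact ⟨⟨i, by omega⟩, ⟨i + 1, h1⟩, rfl, rfl⟩
  · rw [VW, VW, dif_neg h1, smul_zero]
    split_ifs with h
    · rw [← Submodule.Quotient.mk_smul, Submodule.Quotient.mk_eq_zero]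
      apply Submodule.subset_span
      refine Or.inl (Or.inl (Or.inr ?_))
      simp only [Set.mem_iUnion, Set.mem_singleton_iff]
      exact ⟨⟨i, h⟩, by simp only; omega, rfl⟩
    · rw [smul_zero]

lemma xpow_VW_zero (d i a : ℕ) (h : i < a) : xA k p ^ a • VW k p d i = 0 :=
  gen_xpow_zero (xA k p) (yA k p) (VW k p d) (x_VW_zero k p d) (y_VW k p d) i a h

lemma mono_VW (d i a b : ℕ) :
    (xA k p ^ a * yA k p ^ b) • VW k p d i = xA k p ^ (a + b) • VW k p d (i + b) :=
  gen_mono (xA k p) (yA k p) (VW k p d) (y_VW k p d) i a b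

lemma VW_ge (d i : ℕ) (h : d ≤ i) : VW k p d i = 0 := by
  rw [VW, dif_neg (by omega)]

/-- The reconstruction map. -/
def rec0 (d : ℕ) : Amod k p →ₗ[k] Wmod k p d d :=
  ∑ q ∈ Finset.range d ×ˢ Finset.range d,
    (cf k p (p - 1 - q.1 + q.2) (p - d + q.1)).smulRight (xA k p ^ q.2 • VW k p d q.1)

lemma rec0_basis (d : ℕ) (hdp : d ≤ p) (i a : ℕ) :
    rec0 k p d (phi k p d hdp (xA k p ^ a • VW k p d i)) = xA k p ^ a • VW k p d i := by
  by_cases hi : i < d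
  · by_cases ha : a ≤ i
    · rw [map_smul, phi_VW k p d hdp i hi, gA, smul_eq_mul, ← mul_assoc, ← pow_add, rec0,
        LinearMap.sum_apply, Finset.sum_eq_single (i, a)]
      · rw [LinearMap.smulRight_apply, cf_mono, if_pos, one_smul]
        exact ⟨by simp only; omega, rfl, by simp only; omega, by simp only; omega⟩
      · rintro ⟨i', a'⟩ h hne
        simp only [Finset.mem_product, Finset.mem_range] at h
        rw [LinearMap.smulRight_apply, cf_mono, if_neg, zero_smul]
        simp only
        intro hh
        apply hne
        rw [Prod.mk.injEq]
        omega
      · intro hn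
        simp only [Finset.mem_product, Finset.mem_range] at hn
        omega
    · rw [xpow_VW_zero k p d i a (by omega), map_zero, map_zero]
  · rw [VW_ge k p d i (by omega), smul_zero, map_zero, map_zero]

lemma rec0_phi_smul (d : ℕ) (hdp : d ≤ p) (i : ℕ) (r : Amod k p) :
    rec0 k p d (phi k p d hdp (r • VW k p d i)) = r • VW k p d i := by
  have : (rec0 k p d).comp (((phi k p d hdp).restrictScalars k).comp
      ((LinearMap.toSpanSingleton (Amod k p) _ (VW k p d i)).restrictScalars k)) =
      (LinearMap.toSpanSingleton (Amod k p) _ (VW k p d i)).restrictScalars k := by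
    apply extA
    intro a b
    simp only [LinearMap.comp_apply, LinearMap.restrictScalars_apply,
      LinearMap.toSpanSingleton_apply]
    rw [mono_VW, rec0_basis]
  exact LinearMap.congr_fun this r

lemma rec0_phi (d : ℕ) (hdp : d ≤ p) (z : Wmod k p d d) :
    rec0 k p d (phi k p d hdp z) = z := by
  obtain ⟨f, rfl⟩ := Submodule.Quotient.mk_surjective _ z
  have : (Submodule.Quotient.mk f : Wmod k p d d) = ∑ i : Fin d, f i • VW k p d i := by
    have hf : f = ∑ i : Fin d, f i • stdV k p d i := by
      ext j
      simp [stdV, Finset.sum_apply, Pi.single_apply]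
    conv_lhs => rw [hf]
    rw [← Submodule.mkQ_apply, map_sum]
    refine Finset.sum_congr rfl fun i _ => ?_
    rw [map_smul, VW, dif_pos i.2]
    rfl
  rw [this, map_sum, map_sum]
  exact Finset.sum_congr rfl fun i _ => rec0_phi_smul k p d hdp i _

lemma phi_range (d : ℕ) (hdp : d ≤ p) (hd1 : 1 ≤ d) :
    LinearMap.range (phi k p d hdp) = mA k p ^ (2 * p - 1 - d) := by
  apply le_antisymm
  · rintro _ ⟨z, rfl⟩
    obtain ⟨f, rfl⟩ := Submodule.Quotient.mk_surjective _ z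
    change phi0 k p d f ∈ _
    rw [phi0, Fintype.linearCombination_apply]
    refine Submodule.sum_mem _ fun i _ => Submodule.smul_mem _ _ ?_
    have := i.2
    exact mono_mem k p (by omega)
  · apply span_pair_pow_le
    intro i j hij
    by_cases h : i < p ∧ j < p
    · refine ⟨VW k p d (p - 1 - i), ?_⟩
      rw [phi_VW k p d hdp _ (by omega), gA]
      congr 2 <;> omega
    · rcases not_and_or.1 h with h | h
      · rw [xA_pow_ge k p (not_lt.1 h), zero_mul]
        exact Submodule.zero_mem _
      · rw [yA_pow_ge k p (not_lt.1 h), mul_zero]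
        exact Submodule.zero_mem _

/-- `𝔪^{2p−1−d}` lies in `EIP_d`, contains every `EIP_d` submodule of `A`,
and is isomorphic to `W_{d,d}` as an `A`-module. -/
theorem mPow_largest_EIPd_submodule_of_A
    [IsAlgClosed k] [Fact p.Prime] [CharP k p]
    (d : ℕ) (hd1 : 1 ≤ d) (hdp : d ≤ p) :
    EIPd k p d (↥((mA k p) ^ (2 * p - 1 - d))) ∧
    (∀ J : Submodule (Amod k p) (Amod k p),
      EIPd k p d J → J ≤ (mA k p) ^ (2 * p - 1 - d)) ∧
    Nonempty ((↥((mA k p) ^ (2 * p - 1 - d))) ≃ₗ[Amod k p] Wmod k p d d) := by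
  exact ⟨eipd_pow k p d hdp, fun J hJ => eipd_le k p d J hJ,
    ⟨((LinearEquiv.ofInjective (phi k p d hdp)
      (Function.LeftInverse.injective (rec0_phi k p d hdp))).trans
      (LinearEquiv.ofEq _ _ (phi_range k p d hdp hd1))).symm⟩⟩

end
end

section
/- Let p ≥ 3, d ∈ {3,…,p} and n ≥ d+2. Then the modules W_{n,d}/U, with U ranging over the one-dimensional k-subspaces of 𝔪^{d−1}·W_{n,d} (a space of dimension n−d+1 ≥ 3, so these subspaces form a projective space of dimension n−d ≥ 2 over k), are pairwise non-isomorphic indecomposable A-modules having the equal images property, all of the same k-dimension dim_k W_{n,d} − 1. In particular, for every m ∈ ℕ there is a dimension in which there are infinitely many pairwise non-isomorphic indecomposable A-modules with the equal images property, parametrized injectively by a projective space of dimension at least m. -/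
open MvPolynomial Module

set_option maxHeartbeats 1000000
set_option synthInstance.maxHeartbeats 400000

noncomputable section

variable (k : Type) [Field k] (p : ℕ)

/-- `M` has constant Jordan type `⊕ a_i [i]`: for every point operator `u`, the nilpotent
operator `u_M` has exactly `a i` Jordan blocks of size `i` (`1 ≤ i ≤ p`), expressed through
ranks: `rank(u_M^j) = Σ_{i=j+1}^p (i−j)·a i` for `1 ≤ j ≤ p−1` and
`dim_k M = Σ_{i=1}^p i·a i`. -/
def ConstantJordanType (a : ℕ → ℕ) (M : Type) [AddCommGroup M] [Module (Amod k p) M]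
    [Module k M] [IsScalarTower k (Amod k p) M] : Prop :=
  finrank k M = ∑ i ∈ Finset.Icc 1 p, i * a i ∧
  ∀ u : Amod k p, IsPointOp k p u → ∀ j : ℕ, 1 ≤ j → j ≤ p - 1 →
    finrank k (↥(LinearMap.range ((LinearMap.lsmul (Amod k p) M u) ^ j)))
      = ∑ i ∈ Finset.Icc (j + 1) p, (i - j) * a i

/-- `M` is an indecomposable `A`-module: it is nonzero and admits no nontrivial internal
direct sum decomposition. -/
def IsIndecomposableMod (M : Type) [AddCommGroup M] [Module (Amod k p) M] : Prop :=
  Nontrivial M ∧ ∀ N N' : Submodule (Amod k p) M, IsCompl N N' → N = ⊥ ∨ N' = ⊥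


section
variable {k p}
namespace WQ

abbrev T (k : Type) [Field k] := TrivSqZeroExt k (Fin 2 → k)

def PhiP (k : Type) [Field k] : MvPolynomial (Fin 2) k →ₐ[k] T k :=
  MvPolynomial.aeval (fun i => TrivSqZeroExt.inr (Pi.single i 1))

theorem sq_zero (i : Fin 2) (hp : 2 ≤ p) :
    (TrivSqZeroExt.inr (Pi.single i 1) : T k) ^ p = 0 := by
  obtain ⟨q, rfl⟩ := Nat.exists_eq_add_of_le hp
  rw [pow_add, pow_two, TrivSqZeroExt.inr_mul_inr, zero_mul]

theorem PhiP_ker (hp : 2 ≤ p) : ∀ a ∈ relI k p, PhiP k a = 0 := by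
  intro a ha
  have : relI k p ≤ RingHom.ker (PhiP k) := by
    unfold relI
    rw [Ideal.span_le]
    rintro _ (rfl | rfl) <;> simp [PhiP, RingHom.mem_ker, sq_zero _ hp]
  exact this ha

def Phi (hp : 2 ≤ p) : Amod k p →ₐ[k] T k := Ideal.Quotient.liftₐ (relI k p) (PhiP k) (PhiP_ker hp)

theorem Phi_x (hp : 2 ≤ p) : Phi hp (xA k p) = TrivSqZeroExt.inr (Pi.single 0 1) := by
  change PhiP k (X 0) = _
  simp [PhiP]
theorem Phi_y (hp : 2 ≤ p) : Phi hp (yA k p) = TrivSqZeroExt.inr (Pi.single 1 1) := by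
  change PhiP k (X 1) = _
  simp [PhiP]

theorem sub_mem (hp : 2 ≤ p) (a : Amod k p) :
    a - algebraMap k (Amod k p) (Phi hp a).fst ∈ mA k p := by
  obtain ⟨f, rfl⟩ := Ideal.Quotient.mk_surjective a
  induction f using MvPolynomial.induction_on with
  | C r =>
    have : (Ideal.Quotient.mk (relI k p) (C r)) = algebraMap k (Amod k p) r := rfl
    rw [this, AlgHom.commutes, TrivSqZeroExt.algebraMap_eq_inl, TrivSqZeroExt.fst_inl, sub_self]
    exact zero_mem _
  | add f g hf hg =>
    rw [map_add, map_add, TrivSqZeroExt.fst_add, map_add]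
    convert add_mem hf hg using 1
    ring
  | mul_X f i hf =>
    rw [map_mul, map_mul, TrivSqZeroExt.fst_mul]
    have hx : Ideal.Quotient.mk (relI k p) (X i) ∈ mA k p := by
      unfold mA
      apply Ideal.subset_span
      fin_cases i
      · left; rfl
      · right; rfl
    have : (Phi hp (Ideal.Quotient.mk (relI k p) (X i))).fst = 0 := by
      fin_cases i
      · change (Phi hp (xA k p)).fst = 0
        simp [Phi_x]
      · change (Phi hp (yA k p)).fst = 0
        simp [Phi_y]
    rw [this, mul_zero, map_zero, sub_zero]
    exact Ideal.mul_mem_left _ _ hx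

theorem mem_mA_iff (hp : 2 ≤ p) (a : Amod k p) : a ∈ mA k p ↔ (Phi hp a).fst = 0 := by
  constructor
  · intro h
    have : mA k p ≤ RingHom.ker ((TrivSqZeroExt.fstHom k k (Fin 2 → k)).comp (Phi hp)) := by
      unfold mA
      rw [Ideal.span_le]
      rintro _ (rfl | rfl) <;> simp [RingHom.mem_ker, Phi_x, Phi_y]
    exact this h
  · intro h
    have := sub_mem hp a
    rwa [h, map_zero, sub_zero] at this

/-- Auxiliary submodule: no constant terms, and vanishing degree-one part in `W`. -/
def P (hp : 2 ≤ p) (n : ℕ) : Submodule (Amod k p) (Fin n → Amod k p) where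
  carrier := {f | (∀ i, (Phi hp (f i)).fst = 0) ∧
    ∀ i j : Fin n, j.val = i.val + 1 → (Phi hp (f j)).snd 0 + (Phi hp (f i)).snd 1 = 0}
  zero_mem' := by simp
  add_mem' := by
    rintro f g ⟨hf, hf'⟩ ⟨hg, hg'⟩
    refine ⟨fun i => by simp [hf, hg], fun i j h => ?_⟩
    have h1 := hf' i j h
    have h2 := hg' i j h
    simp only [Pi.add_apply, map_add, TrivSqZeroExt.snd_add]
    linear_combination h1 + h2
  smul_mem' := by
    rintro a f ⟨hf, hf'⟩
    refine ⟨fun i => by simp [hf], fun i j h => ?_⟩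
    have h1 := hf' i j h
    simp [TrivSqZeroExt.snd_mul, hf]
    linear_combination (Phi hp a).fst * h1

theorem smul_mem_P (hp : 2 ≤ p) {n : ℕ} {a : Amod k p} {f : Fin n → Amod k p}
    (ha : a ∈ mA k p) (hf : ∀ i, (Phi hp (f i)).fst = 0) : a • f ∈ P hp n := by
  rw [mem_mA_iff hp] at ha
  exact ⟨fun i => by simp [ha], fun i j h => by simp [TrivSqZeroExt.snd_mul, hf, ha]⟩

theorem x_mem : xA k p ∈ mA k p := Ideal.subset_span (by simp)
theorem y_mem : yA k p ∈ mA k p := Ideal.subset_span (by simp)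

theorem m_top (hp : 2 ≤ p) {n : ℕ} (f : Fin n → Amod k p) :
    f ∈ mA k p • (⊤ : Submodule (Amod k p) (Fin n → Amod k p)) ↔
      ∀ i, (Phi hp (f i)).fst = 0 := by
  constructor
  · intro h
    induction h using Submodule.smul_induction_on' with
    | smul a ha g hg =>
      rw [mem_mA_iff hp] at ha
      intro i; simp [ha]
    | add a _ b _ ha hb => intro i; simp [ha i, hb i]
  · intro h
    have : f = ∑ i, f i • (Pi.single i 1 : Fin n → Amod k p) := by
      ext j; simp [Finset.sum_apply, Pi.single_apply]
    rw [this]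
    exact sum_mem fun i _ => Submodule.smul_mem_smul ((mem_mA_iff hp _).2 (h i)) trivial

theorem m2_le (hp : 2 ≤ p) (n : ℕ) :
    mA k p ^ 2 • (⊤ : Submodule (Amod k p) (Fin n → Amod k p)) ≤ P hp n := by
  rw [pow_two, ← smul_eq_mul, Submodule.smul_assoc, Submodule.smul_le]
  intro a ha f hf
  exact smul_mem_P hp ha ((m_top hp f).1 hf)

theorem N_le (hp : 2 ≤ p) (n d : ℕ) (hd : 2 ≤ d) : NSub k p n d ≤ P hp n := by
  unfold NSub
  rw [Submodule.span_le]
  intro f hf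
  simp only [NSet, Set.mem_union, Set.mem_iUnion, Set.mem_singleton_iff] at hf
  have hs : ∀ i j : Fin n, Phi hp (stdV k p n i j) = if j = i then 1 else 0 := by
    intro i j
    simp only [stdV, Pi.single_apply]
    split_ifs <;> simp
  rcases hf with ((⟨i, hi, rfl⟩ | ⟨i, hi, rfl⟩) | ⟨i, hi, rfl⟩) | ⟨i, j, hij, rfl⟩
  · refine ⟨fun l => by simp [Phi_x], fun a b h => ?_⟩
    have : b ≠ i := by rintro rfl; omega
    simp [Phi_x, hs, this]
    split_ifs <;> simp
  · refine ⟨fun l => by simp [Phi_y], fun a b h => ?_⟩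
    have : a ≠ i := by rintro rfl; omega
    simp [Phi_y, hs, this]
    split_ifs <;> simp
  · have : (Phi hp (xA k p)) ^ d = 0 := by rw [Phi_x, sq_zero _ hd]
    exact ⟨fun l => by simp [this], fun a b h => by simp [this]⟩
  · refine ⟨fun l => by simp [Phi_x, Phi_y], fun a b h => ?_⟩
    by_cases h1 : a = i
    · have h2 : b = j := by ext; rw [h, hij, h1]
      subst h1 h2
      simp [Phi_x, Phi_y, hs]
      split_ifs <;> simp
    · have h2 : b ≠ j := by rintro rfl; apply h1; ext; omega
      simp [Phi_x, Phi_y, hs, h1, h2]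
      split_ifs <;> simp

theorem zs {M : Type} [AddCommGroup M] [Module (Amod k p) M] (w : M) :
    algebraMap k (Amod k p) 0 • w = 0 := by
  rw [map_zero]; exact zero_smul (Amod k p) w

theorem pows {M : Type} [AddCommGroup M] [Module (Amod k p) M] (a : Amod k p) (j : ℕ) (w : M) :
    a ^ (j + 1) • w = a ^ j • a • w := by
  rw [pow_succ]; exact mul_smul _ _ w

theorem ksmul (c : k) (a : Amod k p) : c • a = algebraMap k (Amod k p) c * a :=
  Algebra.smul_def c a

theorem sub_zs {M M' : Type} [AddCommGroup M] [Module (Amod k p) M] [AddCommGroup M']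
    [Module (Amod k p) M'] (g h : M →ₗ[Amod k p] M') :
    g - algebraMap k (Amod k p) 0 • h = g := by
  refine LinearMap.ext fun w => ?_
  change g w - algebraMap k (Amod k p) 0 • h w = g w
  rw [zs, sub_zero]

theorem mpow_gen {R M : Type} [CommRing R] [AddCommGroup M] [Module R M] (I : Ideal R) (j : ℕ)
    (N : Submodule R M) : I ^ (j + 1) • N = I • I ^ j • N := by
  rw [pow_succ', ← smul_eq_mul, Submodule.smul_assoc]

theorem mpow_gen' {R M : Type} [CommRing R] [AddCommGroup M] [Module R M] (I : Ideal R) (j : ℕ)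
    (N : Submodule R M) : I ^ (j + 1) • N = I ^ j • I • N := by
  rw [pow_succ, ← smul_eq_mul, Submodule.smul_assoc]

theorem mpow {M : Type} [AddCommGroup M] [Module (Amod k p) M] (j : ℕ) (N : Submodule (Amod k p) M) :
    mA k p ^ (j + 1) • N = mA k p • mA k p ^ j • N :=
  mpow_gen _ _ _

theorem mpow' {M : Type} [AddCommGroup M] [Module (Amod k p) M] (j : ℕ) (N : Submodule (Amod k p) M) :
    mA k p ^ (j + 1) • N = mA k p ^ j • mA k p • N :=
  mpow_gen' _ _ _

theorem mono_r {M : Type} [AddCommGroup M] [Module (Amod k p) M] (I : Ideal (Amod k p))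
    {N N' : Submodule (Amod k p) M} (h : N ≤ N') : I • N ≤ I • N' :=
  Submodule.smul_mono le_rfl h

theorem eq_sum {n : ℕ} (f : Fin n → Amod k p) : f = ∑ i, f i • stdV k p n i := by
  ext j; simp [stdV, Finset.sum_apply, Pi.single_apply]

/-- generators of `W` -/
def vW (k : Type) [Field k] (p n d : ℕ) (i : Fin n) : Wmod k p n d := (NSub k p n d).mkQ (stdV k p n i)

theorem W_sum {n d : ℕ} (w : Wmod k p n d) : ∃ f : Fin n → Amod k p, w = ∑ i, f i • vW k p n d i := by
  obtain ⟨f, rfl⟩ := (NSub k p n d).mkQ_surjective w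
  refine ⟨f, ?_⟩
  conv_lhs => rw [eq_sum f]
  simp only [map_sum, map_smul, vW]

theorem rel0 {n d : ℕ} {f : Fin n → Amod k p} (h : f ∈ NSet k p n d) :
    (NSub k p n d).mkQ f = 0 := by
  rw [← LinearMap.mem_ker, Submodule.ker_mkQ]
  exact Submodule.subset_span h

theorem rel_x {n d : ℕ} (i : Fin n) (hi : i.val = 0) : xA k p • vW k p n d i = 0 := by
  rw [vW, ← map_smul]
  apply rel0
  simp only [NSet, Set.mem_union, Set.mem_iUnion, Set.mem_singleton_iff]
  exact Or.inl (Or.inl (Or.inl ⟨i, hi, rfl⟩))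

theorem rel_y {n d : ℕ} (i : Fin n) (hi : i.val = n - 1) : yA k p • vW k p n d i = 0 := by
  rw [vW, ← map_smul]
  apply rel0
  simp only [NSet, Set.mem_union, Set.mem_iUnion, Set.mem_singleton_iff]
  exact Or.inl (Or.inl (Or.inr ⟨i, hi, rfl⟩))

theorem rel_xd {n d : ℕ} (hd : 1 ≤ d) (i : Fin n) : xA k p ^ d • vW k p n d i = 0 := by
  by_cases hi : i.val = 0
  · obtain ⟨e, rfl⟩ := Nat.exists_eq_add_of_le hd
    rw [add_comm, pows, rel_x i hi, smul_zero]
  rw [vW, ← map_smul]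
  apply rel0
  simp only [NSet, Set.mem_union, Set.mem_iUnion, Set.mem_singleton_iff]
  exact Or.inl (Or.inr ⟨i, hi, rfl⟩)

theorem rel_yx {n d : ℕ} (i j : Fin n) (hij : j.val = i.val + 1) :
    yA k p • vW k p n d i = xA k p • vW k p n d j := by
  rw [vW, vW, ← sub_eq_zero, ← map_smul, ← map_smul, ← map_sub]
  apply rel0
  simp only [NSet, Set.mem_union, Set.mem_iUnion, Set.mem_singleton_iff]
  exact Or.inr ⟨i, j, hij, rfl⟩

theorem m_le {n d : ℕ} (R : Submodule (Amod k p) (Wmod k p n d))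
    (hx : ∀ i, xA k p • vW k p n d i ∈ R) (hy : ∀ i, yA k p • vW k p n d i ∈ R) :
    mA k p • (⊤ : Submodule (Amod k p) (Wmod k p n d)) ≤ R := by
  rw [Submodule.smul_le]
  intro a ha w _
  obtain ⟨f, rfl⟩ := W_sum w
  obtain ⟨r, s, rfl⟩ := Ideal.mem_span_pair.1 ha
  rw [Finset.smul_sum]
  refine sum_mem fun i _ => ?_
  rw [smul_comm, add_smul, mul_smul, mul_smul]
  exact R.smul_mem _ (add_mem (R.smul_mem _ (hx i)) (R.smul_mem _ (hy i)))

theorem pt_mem {u : Amod k p} (hu : IsPointOp k p u) : u ∈ mA k p := by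
  obtain ⟨α, β, _, rfl⟩ := hu
  rw [ksmul, ksmul]
  exact add_mem (Ideal.mul_mem_left _ _ x_mem) (Ideal.mul_mem_left _ _ y_mem)

theorem unit_mem {M : Type} [AddCommGroup M] [Module (Amod k p) M] (R : Submodule (Amod k p) M)
    {α : k} (hα : α ≠ 0) {w : M} (h : algebraMap k (Amod k p) α • w ∈ R) : w ∈ R := by
  have := R.smul_mem (algebraMap k (Amod k p) α⁻¹) h
  rwa [smul_smul, ← map_mul, inv_mul_cancel₀ hα, map_one, one_smul] at this

theorem EIP_W (n d : ℕ) : EIP k p (Wmod k p n d) := by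
  intro u hu
  apply le_antisymm
  · rintro _ ⟨w, rfl⟩
    exact Submodule.smul_mem_smul (pt_mem hu) trivial
  obtain ⟨α, β, hab, rfl⟩ := hu
  set u := α • xA k p + β • yA k p with hu
  set R := LinearMap.range (LinearMap.lsmul (Amod k p) (Wmod k p n d) u) with hR
  have key : ∀ w : Wmod k p n d, algebraMap k (Amod k p) α • xA k p • w +
      algebraMap k (Amod k p) β • yA k p • w ∈ R := by
    intro w
    refine ⟨w, ?_⟩
    rw [LinearMap.lsmul_apply, hu, add_smul, ksmul, ksmul, mul_smul, mul_smul]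
  have succ : ∀ i : Fin n, i.val = n - 1 ∨ ∃ j : Fin n, j.val = i.val + 1 := by
    intro i
    by_cases h : i.val = n - 1
    · exact Or.inl h
    · exact Or.inr ⟨⟨i.val + 1, by omega⟩, rfl⟩
  by_cases hα : α = 0
  · have hβ : β ≠ 0 := by simpa [hα] using hab
    have hy : ∀ i, yA k p • vW k p n d i ∈ R := by
      intro i
      have := key (vW k p n d i)
      rw [hα, zs, zero_add] at this
      exact unit_mem R hβ this
    refine m_le R (fun i => ?_) hy
    by_cases h : i.val = 0
    · rw [rel_x i h]; exact zero_mem _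
    · rw [← rel_yx ⟨i.val - 1, by omega⟩ i (by simp; omega)]
      exact hy _
  · have hx : ∀ e : ℕ, ∀ i : Fin n, i.val + e = n - 1 → xA k p • vW k p n d i ∈ R := by
      intro e
      induction e with
      | zero =>
        intro i hi
        have := key (vW k p n d i)
        rw [rel_y i hi, smul_zero, add_zero] at this
        exact unit_mem R hα this
      | succ e ih =>
        intro i hi
        have h1 := key (vW k p n d i)
        have h2 := ih ⟨i.val + 1, by omega⟩ (by simp; omega)
        rw [rel_yx i ⟨i.val + 1, by omega⟩ rfl] at h1
        exact unit_mem R hα ((Submodule.add_mem_iff_left R (R.smul_mem _ h2)).1 h1)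
    have hx' : ∀ i, xA k p • vW k p n d i ∈ R := fun i => hx (n - 1 - i.val) i (by omega)
    refine m_le R hx' fun i => ?_
    rcases succ i with h | ⟨j, h⟩
    · rw [rel_y i h]; exact zero_mem _
    · rw [rel_yx i j h]; exact hx' j

theorem x_top (n d : ℕ) (w : Wmod k p n d)
    (hw : w ∈ mA k p • (⊤ : Submodule (Amod k p) (Wmod k p n d))) : ∃ w', xA k p • w' = w := by
  rw [← EIP_W n d (xA k p) ⟨1, 0, by simp, by simp⟩] at hw
  exact hw

theorem m_pow (n d j : ℕ) : mA k p ^ j • (⊤ : Submodule (Amod k p) (Wmod k p n d)) ≤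
    LinearMap.range (LinearMap.lsmul (Amod k p) (Wmod k p n d) (xA k p ^ j)) := by
  induction j with
  | zero => intro w _; exact ⟨w, by simp⟩
  | succ j ih =>
    rw [mpow, Submodule.smul_le]
    intro a ha w hw
    obtain ⟨w', rfl⟩ := ih hw
    obtain ⟨w'', h⟩ := x_top n d (a • w') (Submodule.smul_mem_smul ha trivial)
    refine ⟨w'', ?_⟩
    simp only [LinearMap.lsmul_apply]
    rw [pows, h, smul_comm]

theorem m_pow_d (n d : ℕ) (hd : 1 ≤ d) :
    mA k p ^ d • (⊤ : Submodule (Amod k p) (Wmod k p n d)) = ⊥ := by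
  rw [eq_bot_iff]
  intro w hw
  obtain ⟨w', rfl⟩ := m_pow n d d hw
  obtain ⟨f, rfl⟩ := W_sum w'
  simp only [LinearMap.lsmul_apply, Finset.smul_sum, Submodule.mem_bot]
  refine Finset.sum_eq_zero fun i _ => ?_
  rw [smul_comm, rel_xd hd, smul_zero]

theorem m_map {M : Type} [AddCommGroup M] [Module (Amod k p) M] (U : Submodule (Amod k p) M)
    (I : Ideal (Amod k p)) :
    (I • (⊤ : Submodule (Amod k p) M)).map U.mkQ = I • (⊤ : Submodule (Amod k p) (M ⧸ U)) := by
  rw [Submodule.map_smul'', Submodule.map_top, Submodule.range_mkQ]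

theorem EIP_quot {M : Type} [AddCommGroup M] [Module (Amod k p) M] (h : EIP k p M)
    (U : Submodule (Amod k p) M) : EIP k p (M ⧸ U) := by
  intro u hu
  apply le_antisymm
  · rintro _ ⟨w, rfl⟩
    exact Submodule.smul_mem_smul (pt_mem hu) trivial
  · rw [← m_map, ← h u hu]
    rintro _ ⟨_, ⟨w, rfl⟩, rfl⟩
    exact ⟨U.mkQ w, by simp⟩

theorem nilp {n d : ℕ} (hd : 1 ≤ d) (U : Submodule (Amod k p) (Wmod k p n d)) :
    mA k p ^ d • (⊤ : Submodule (Amod k p) (Wmod k p n d ⧸ U)) = ⊥ := by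
  rw [← m_map, m_pow_d n d hd, Submodule.map_bot]

theorem nak {M : Type} [AddCommGroup M] [Module (Amod k p) M] {d : ℕ}
    (hM : mA k p ^ d • (⊤ : Submodule (Amod k p) M) = ⊥) (N : Submodule (Amod k p) M)
    (hN : N ≤ mA k p • N) : N = ⊥ := by
  have : ∀ j, N ≤ mA k p ^ j • N := by
    intro j
    induction j with
    | zero => simp
    | succ j ih =>
      rw [mpow]
      exact hN.trans (mono_r _ ih)
  rw [eq_bot_iff, ← hM]
  exact (this d).trans (mono_r _ le_top)

theorem nak_top {M : Type} [AddCommGroup M] [Module (Amod k p) M] {d : ℕ}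
    (hM : mA k p ^ d • (⊤ : Submodule (Amod k p) M) = ⊥) (N : Submodule (Amod k p) M)
    (hN : ⊤ ≤ N ⊔ mA k p • ⊤) : N = ⊤ := by
  have : ∀ j, ⊤ ≤ N ⊔ mA k p ^ j • (⊤ : Submodule (Amod k p) M) := by
    intro j
    induction j with
    | zero => simp
    | succ j ih =>
      refine hN.trans (sup_le le_sup_left ?_)
      refine (mono_r (mA k p) ih).trans ?_
      rw [Submodule.smul_sup, mpow]
      exact sup_le_sup_right Submodule.smul_le_right _
  have := this d
  rw [hM, sup_bot_eq] at this
  exact eq_top_iff.2 this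

theorem mem_P (hp : 2 ≤ p) {n d : ℕ} (hd : 2 ≤ d) {U : Submodule (Amod k p) (Wmod k p n d)}
    (hU : U ≤ mA k p ^ 2 • ⊤) {f : Fin n → Amod k p}
    (hf : U.mkQ ((NSub k p n d).mkQ f) = 0) : f ∈ P hp n := by
  rw [← LinearMap.mem_ker, Submodule.ker_mkQ] at hf
  have h := hU hf
  rw [← m_map] at h
  have h2 : f ∈ Submodule.comap (NSub k p n d).mkQ (Submodule.map (NSub k p n d).mkQ
    (mA k p ^ 2 • (⊤ : Submodule (Amod k p) (Fin n → Amod k p)))) := h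
  rw [Submodule.comap_map_eq, Submodule.ker_mkQ] at h2
  exact sup_le (m2_le hp n) (N_le hp n d hd) h2

theorem nontriv (hp : 2 ≤ p) {n d : ℕ} (hd : 2 ≤ d) (hn : 0 < n)
    {U : Submodule (Amod k p) (Wmod k p n d)}
    (hU : U ≤ mA k p ^ 2 • ⊤) : Nontrivial (Wmod k p n d ⧸ U) := by
  by_contra h
  rw [not_nontrivial_iff_subsingleton] at h
  have := mem_P hp hd hU (f := stdV k p n ⟨0, hn⟩) (Subsingleton.elim _ _)
  have := this.1 ⟨0, hn⟩
  simp [stdV] at this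

theorem scalar (hp : 2 ≤ p) {n d : ℕ} (hd : 2 ≤ d) (hn : 0 < n)
    {U : Submodule (Amod k p) (Wmod k p n d)} (hU : U ≤ mA k p ^ 2 • ⊤)
    (g : Wmod k p n d →ₗ[Amod k p] Wmod k p n d ⧸ U) :
    ∃ c : k, LinearMap.range (g - algebraMap k (Amod k p) c • U.mkQ) ≤ mA k p • ⊤ := by
  have hs : ∀ w : Wmod k p n d ⧸ U, ∃ f, U.mkQ ((NSub k p n d).mkQ f) = w := by
    intro w
    obtain ⟨w, rfl⟩ := U.mkQ_surjective w
    obtain ⟨f, rfl⟩ := (NSub k p n d).mkQ_surjective w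
    exact ⟨f, rfl⟩
  choose F hF using fun i => hs (g (vW k p n d i))
  set a : Fin n → Fin n → k := fun i j => (Phi hp (F i j)).fst with ha
  have h0 : ∀ i : Fin n, i.val = 0 → ∀ j : Fin n, j.val ≠ 0 → a i j = 0 := by
    intro i hi j hj
    have : xA k p • F i ∈ P hp n := mem_P hp hd hU (by
      rw [map_smul, map_smul, hF, ← map_smul, rel_x i hi, map_zero])
    have := this.2 ⟨j.val - 1, by omega⟩ j (by simp; omega)
    simpa [Phi_x, TrivSqZeroExt.snd_mul] using this
  have h1 : ∀ i : Fin n, i.val = n - 1 → ∀ j : Fin n, j.val ≠ n - 1 → a i j = 0 := by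
    intro i hi j hj
    have : yA k p • F i ∈ P hp n := mem_P hp hd hU (by
      rw [map_smul, map_smul, hF, ← map_smul, rel_y i hi, map_zero])
    have := this.2 j ⟨j.val + 1, by omega⟩ rfl
    simpa [Phi_y, TrivSqZeroExt.snd_mul] using this
  have h2 : ∀ i i' : Fin n, i'.val = i.val + 1 → ∀ j j' : Fin n, j'.val = j.val + 1 →
      a i j = a i' j' := by
    intro i i' hi j j' hj
    have : yA k p • F i - xA k p • F i' ∈ P hp n := mem_P hp hd hU (by
      rw [map_sub, map_sub, map_smul, map_smul, map_smul, map_smul, hF, hF, ← map_smul, ← map_smul,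
        rel_yx i i' hi, sub_self])
    have := this.2 j j' hj
    simp [Phi_x, Phi_y, TrivSqZeroExt.snd_mul] at this
    simp only [ha]
    linear_combination this
  have up : ∀ e : ℕ, ∀ i j : Fin n, i.val = e → i.val < j.val → a i j = 0 := by
    intro e
    induction e with
    | zero => intro i j hi hj; exact h0 i hi j (by omega)
    | succ e ih =>
      intro i j hi hj
      rw [← h2 ⟨e, by omega⟩ i (by simp [hi]) ⟨j.val - 1, by omega⟩ j (by simp; omega)]
      exact ih _ _ rfl (by simp; omega)
  have lo : ∀ e : ℕ, ∀ i j : Fin n, i.val + e = n - 1 → j.val < i.val → a i j = 0 := by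
    intro e
    induction e with
    | zero => intro i j hi hj; exact h1 i hi j (by omega)
    | succ e ih =>
      intro i j hi hj
      rw [h2 i ⟨i.val + 1, by omega⟩ rfl j ⟨j.val + 1, by omega⟩ rfl]
      exact ih _ _ (by simp; omega) (by simp; omega)
  have di : ∀ e : ℕ, ∀ i : Fin n, i.val = e → a i i = a ⟨0, hn⟩ ⟨0, hn⟩ := by
    intro e
    induction e with
    | zero =>
      intro i hi
      have : i = ⟨0, hn⟩ := Fin.ext hi
      rw [this]
    | succ e ih =>
      intro i hi
      rw [← h2 ⟨e, by omega⟩ i (by simp [hi]) ⟨e, by omega⟩ i (by simp [hi])]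
      exact ih _ rfl
  refine ⟨a ⟨0, hn⟩ ⟨0, hn⟩, ?_⟩
  set c := a ⟨0, hn⟩ ⟨0, hn⟩ with hc
  have gen : ∀ i, (g - algebraMap k (Amod k p) c • U.mkQ) (vW k p n d i) ∈
      mA k p • (⊤ : Submodule (Amod k p) (Wmod k p n d ⧸ U)) := by
    intro i
    have : (g - algebraMap k (Amod k p) c • U.mkQ) (vW k p n d i) =
        U.mkQ ((NSub k p n d).mkQ (F i - algebraMap k (Amod k p) c • stdV k p n i)) := by
      rw [map_sub, map_sub, hF, map_smul, map_smul]
      rfl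
    rw [this, ← m_map, ← m_map]
    refine Submodule.mem_map_of_mem (Submodule.mem_map_of_mem ((m_top hp _).2 fun j => ?_))
    have hst : (Phi hp (stdV k p n i j)).fst = if j = i then 1 else 0 := by
      simp only [stdV, Pi.single_apply]
      split_ifs <;> simp
    have hcc : (Phi hp (algebraMap k (Amod k p) c)).fst = c := by
      rw [AlgHom.commutes, TrivSqZeroExt.algebraMap_eq_inl, TrivSqZeroExt.fst_inl]
    rw [Pi.sub_apply, Pi.smul_apply, smul_eq_mul, map_sub, map_mul, TrivSqZeroExt.fst_sub,
      TrivSqZeroExt.fst_mul, hst, hcc]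
    change a i j - _ = 0
    rcases lt_trichotomy i.val j.val with h | h | h
    · rw [up _ i j rfl h, if_neg (by rintro rfl; omega)]; simp
    · have h : i = j := Fin.ext h
      subst h
      rw [di _ i rfl]; simp
    · rw [lo (n - 1 - i.val) i j (by omega) h, if_neg (by rintro rfl; omega)]; simp
  rintro _ ⟨w, rfl⟩
  obtain ⟨f, rfl⟩ := W_sum w
  rw [map_sum]
  refine sum_mem fun i _ => ?_
  rw [map_smul]
  exact Submodule.smul_mem _ _ (gen i)

theorem iso_le (hp : 2 ≤ p) {n d : ℕ} (hd : 3 ≤ d) (hn : 0 < n)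
    {U U' : Submodule (Amod k p) (Wmod k p n d)} (hU : U ≤ mA k p ^ (d - 1) • ⊤)
    (hU' : U' ≤ mA k p ^ 2 • ⊤)
    (φ : (Wmod k p n d ⧸ U) ≃ₗ[Amod k p] (Wmod k p n d ⧸ U')) : U ≤ U' := by
  obtain ⟨c, hc⟩ := scalar hp (by omega) hn hU' (φ.toLinearMap ∘ₗ U.mkQ)
  have hnt := nontriv hp (by omega) hn hU'
  have hc0 : c ≠ 0 := by
    rintro rfl
    rw [sub_zs] at hc
    have : (⊤ : Submodule (Amod k p) (Wmod k p n d ⧸ U')) ≤ mA k p • ⊤ := by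
      refine le_trans ?_ hc
      rw [LinearMap.range_eq_top.2]
      exact φ.surjective.comp U.mkQ_surjective
    exact top_ne_bot (nak (nilp (d := d) (by omega) U') ⊤ this)
  intro w hw
  have h1 := Submodule.mem_map_of_mem
    (f := φ.toLinearMap ∘ₗ U.mkQ - algebraMap k (Amod k p) c • U'.mkQ) (hU hw)
  rw [Submodule.map_smul'', Submodule.map_top] at h1
  have h2 := mono_r (mA k p ^ (d - 1)) hc h1
  rw [← mpow', Nat.sub_add_cancel (by omega),
    nilp (by omega), Submodule.mem_bot] at h2
  have h3 : U.mkQ w = 0 := by rw [← LinearMap.mem_ker, Submodule.ker_mkQ]; exact hw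
  rw [LinearMap.sub_apply, LinearMap.comp_apply, h3, map_zero, zero_sub, neg_eq_zero,
    LinearMap.smul_apply, ← map_smul, ← LinearMap.mem_ker, Submodule.ker_mkQ] at h2
  exact unit_mem U' hc0 h2

theorem indec (hp : 2 ≤ p) {n d : ℕ} (hd : 2 ≤ d) (hn : 0 < n)
    {U : Submodule (Amod k p) (Wmod k p n d)} (hU : U ≤ mA k p ^ 2 • ⊤) :
    IsIndecomposableMod k p (Wmod k p n d ⧸ U) := by
  refine ⟨nontriv hp hd hn hU, fun N N' h => ?_⟩
  obtain ⟨c, hc⟩ := scalar hp hd hn hU (N.projection N' h ∘ₗ U.mkQ)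
  by_cases hc0 : c = 0
  · left
    rw [hc0, sub_zs] at hc
    apply nak (nilp (d := d) (by omega) U) N
    have hN : N ≤ mA k p • ⊤ := by
      intro w hw
      apply hc
      obtain ⟨w', rfl⟩ := U.mkQ_surjective w
      exact ⟨w', by simpa using Submodule.projection_apply_of_mem_left h hw⟩
    intro w hw
    have h1 := Submodule.mem_map_of_mem (f := N.projection N' h) (hN hw)
    rw [Submodule.map_smul'', Submodule.map_top, Submodule.range_projection] at h1
    rwa [Submodule.projection_apply_of_mem_left h hw] at h1
  · right
    have : N = ⊤ := by
      apply nak_top (nilp (d := d) (by omega) U) N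
      intro w _
      obtain ⟨w, rfl⟩ := U.mkQ_surjective w
      apply unit_mem _ hc0
      have h1 := hc ⟨w, rfl⟩
      have h2 : N.projection N' h (U.mkQ w) ∈ N := by
        have := LinearMap.mem_range_self (N.projection N' h) (U.mkQ w)
        rwa [Submodule.range_projection] at this
      have h3 : algebraMap k (Amod k p) c • U.mkQ w = N.projection N' h (U.mkQ w) -
        (N.projection N' h ∘ₗ U.mkQ - algebraMap k (Amod k p) c • U.mkQ) w := by
        rw [LinearMap.sub_apply, LinearMap.comp_apply, LinearMap.smul_apply]
        abel
      rw [h3]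
      exact Submodule.sub_mem _ (Submodule.mem_sup_left h2) (Submodule.mem_sup_right h1)
    have h4 := h.inf_eq_bot
    rwa [this, top_inf_eq] at h4

theorem finr {n d : ℕ} (U : Submodule (Amod k p) (Wmod k p n d)) (hU : finrank k U = 1) :
    finrank k (Wmod k p n d ⧸ U) = finrank k (Wmod k p n d) - 1 := by
  by_cases h : Module.Finite k (Wmod k p n d)
  · rw [Submodule.finrank_quotient, hU]
  · rw [Module.finrank_of_not_finite h, Module.finrank_of_not_finite]
    intro h2
    apply h
    have h3 : Module.Finite k (U.restrictScalars k) := Module.finite_of_finrank_eq_succ hU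
    have h4 : Module.Finite k (Wmod k p n d ⧸ (U.restrictScalars k)) := h2
    exact Module.Finite.of_submodule_quotient (U.restrictScalars k)

end WQ
end

/-- for `p ≥ 3`, `3 ≤ d ≤ p`, `n ≥ d + 2`, the quotients `W_{n,d}/U`, for `U`
a one-dimensional subspace of `𝔪^{d−1}·W_{n,d}`, are indecomposable equal images modules of
common dimension `dim_k W_{n,d} − 1`, and they are pairwise non-isomorphic (distinct `U`'s
yield non-isomorphic quotients). -/
theorem Wquot_family_pairwise_nonisomorphic
    [IsAlgClosed k] [Fact p.Prime] [CharP k p] (hp3 : 3 ≤ p)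
    (d n : ℕ) (hd3 : 3 ≤ d) (hdp : d ≤ p) (hn : d + 2 ≤ n) :
    (∀ U : Submodule (Amod k p) (Wmod k p n d),
      U ≤ (mA k p) ^ (d - 1) • (⊤ : Submodule (Amod k p) (Wmod k p n d)) →
      finrank k (↥U) = 1 →
      IsIndecomposableMod k p (Wmod k p n d ⧸ U) ∧
      EIP k p (Wmod k p n d ⧸ U) ∧
      finrank k (Wmod k p n d ⧸ U) = finrank k (Wmod k p n d) - 1) ∧
    (∀ U U' : Submodule (Amod k p) (Wmod k p n d),
      U ≤ (mA k p) ^ (d - 1) • (⊤ : Submodule (Amod k p) (Wmod k p n d)) →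
      finrank k (↥U) = 1 →
      U' ≤ (mA k p) ^ (d - 1) • (⊤ : Submodule (Amod k p) (Wmod k p n d)) →
      finrank k (↥U') = 1 →
      Nonempty ((Wmod k p n d ⧸ U) ≃ₗ[Amod k p] (Wmod k p n d ⧸ U')) →
      U = U') := by
  have hp2 : 2 ≤ p := by omega
  have hm : ∀ U : Submodule (Amod k p) (Wmod k p n d),
      U ≤ (mA k p) ^ (d - 1) • (⊤ : Submodule (Amod k p) (Wmod k p n d)) →
      U ≤ (mA k p) ^ 2 • (⊤ : Submodule (Amod k p) (Wmod k p n d)) := fun U h =>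
    h.trans (Submodule.smul_mono_left (Ideal.pow_le_pow_right (by omega)))
  refine ⟨fun U hU h1 => ⟨?_, ?_, ?_⟩, ?_⟩
  · exact WQ.indec hp2 (by omega) (by omega) (hm U hU)
  · exact WQ.EIP_quot (WQ.EIP_W n d) U
  · exact WQ.finr U h1
  · rintro U U' hU _ hU' _ ⟨φ⟩
    exact le_antisymm (WQ.iso_le hp2 hd3 (by omega) hU (hm U' hU') φ)
      (WQ.iso_le hp2 hd3 (by omega) hU' (hm U hU) φ.symm)

end
end
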